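/- For any complex number w with Re(√w) > 0 (principal branch square root), ∫_0^∞ (2/π) · √τ / ((1+τ)²(1+τw)) dτ = 1/(1+√w)². -/

import Mathlib

open MeasureTheory Filter Topology

lemma one_add_I_mul_mem_slitPlane {s : ℂ} (hs : 0 < s.re) (x : ℝ) :
    1 + Complex.I * s * x ∈ Complex.slitPlane := by
  rw [Complex.mem_slitPlane_iff]
  rcases eq_or_ne x 0 with rfl | hx
  · simp
  · right
    simpa using ⟨hs.ne', hx⟩

lemma one_add_sq_mul_sq_eq (s : ℂ) (x : ℝ) :
    1 + s ^ 2 * (x : ℂ) ^ 2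
      = (1 + Complex.I * s * x) * (1 + Complex.I * s * ((-x : ℝ) : ℂ)) := by
  push_cast
  linear_combination (s ^ 2 * (x : ℂ) ^ 2) * Complex.I_sq

lemma one_add_sq_mul_sq_ne_zero {s : ℂ} (hs : 0 < s.re) (x : ℝ) :
    1 + s ^ 2 * (x : ℂ) ^ 2 ≠ 0 := by
  rw [one_add_sq_mul_sq_eq]
  exact mul_ne_zero (Complex.slitPlane_ne_zero (one_add_I_mul_mem_slitPlane hs x))
    (Complex.slitPlane_ne_zero (one_add_I_mul_mem_slitPlane hs (-x)))

lemma one_add_ofReal_sq_ne_zero (x : ℝ) : 1 + (x : ℂ) ^ 2 ≠ 0 := by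
  have : (1 + x ^ 2 : ℝ) ≠ 0 := by positivity
  exact_mod_cast this

lemma re_le_norm_mul_norm_one_add_I_mul (s : ℂ) (x : ℝ) :
    s.re ≤ ‖s‖ * ‖1 + Complex.I * s * x‖ := by
  refine (abs_le_of_sq_le_sq' ?_ (by positivity)).2
  rw [mul_pow, Complex.sq_norm, Complex.sq_norm, Complex.normSq_apply, Complex.normSq_apply]
  simp
  nlinarith [sq_nonneg ((s.re ^ 2 + s.im ^ 2) * x - s.im)]

lemma sq_re_le_sq_norm_mul_norm_one_add {s : ℂ} (hs : 0 < s.re) (x : ℝ) :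
    s.re ^ 2 ≤ ‖s‖ ^ 2 * ‖1 + s ^ 2 * (x : ℂ) ^ 2‖ := by
  rw [one_add_sq_mul_sq_eq, norm_mul]
  calc s.re ^ 2 = s.re * s.re := sq _
    _ ≤ (‖s‖ * ‖1 + Complex.I * s * x‖) * (‖s‖ * ‖1 + Complex.I * s * ((-x : ℝ) : ℂ)‖) :=
      mul_le_mul (re_le_norm_mul_norm_one_add_I_mul s x)
        (re_le_norm_mul_norm_one_add_I_mul s (-x)) hs.le (by positivity)
    _ = _ := by ring

lemma hasDerivAt_log_one_add_I_mul {s : ℂ} (hs : 0 < s.re) (x : ℝ) :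
    HasDerivAt (fun y : ℝ => Complex.log (1 + Complex.I * s * y))
      (Complex.I * s / (1 + Complex.I * s * x)) x := by
  refine HasDerivAt.clog_real ?_ (one_add_I_mul_mem_slitPlane hs x)
  simpa using ((hasDerivAt_id x).ofReal_comp.const_mul (Complex.I * s)).const_add 1

/-- The branch of `arctan (s * x)` along the real axis, for `0 < s.re`. -/
noncomputable def arctanRay (s : ℂ) (x : ℝ) : ℂ :=
  (Complex.log (1 + Complex.I * s * x) - Complex.log (1 + Complex.I * s * ((-x : ℝ) : ℂ)))
    / (2 * Complex.I)

lemma hasDerivAt_arctanRay {s : ℂ} (hs : 0 < s.re) (x : ℝ) :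
    HasDerivAt (arctanRay s) (s / (1 + s ^ 2 * (x : ℂ) ^ 2)) x := by
  have h1 := hasDerivAt_log_one_add_I_mul hs x
  have h2 := (hasDerivAt_log_one_add_I_mul hs (-x)).scomp x (hasDerivAt_neg x)
  refine ((h1.sub h2).div_const (2 * Complex.I)).congr_deriv ?_
  rw [one_add_sq_mul_sq_eq]
  have n1 := Complex.slitPlane_ne_zero (one_add_I_mul_mem_slitPlane hs x)
  have n2 := Complex.slitPlane_ne_zero (one_add_I_mul_mem_slitPlane hs (-x))
  have hI := Complex.I_ne_zero
  simp only [neg_smul, one_smul]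
  field_simp
  push_cast
  ring

lemma tendsto_arctanRay {s : ℂ} (hs : 0 < s.re) :
    Tendsto (arctanRay s) atTop (𝓝 (Real.pi / 2)) := by
  have hinv : Tendsto (fun x : ℝ => ((x⁻¹ : ℝ) : ℂ)) atTop (𝓝 0) := by
    simpa [Function.comp_def] using
      (Complex.continuous_ofReal.tendsto 0).comp tendsto_inv_atTop_zero
  have him : 0 < (Complex.I * s).im := by simpa using hs
  have hI : Complex.I * s ∈ Complex.slitPlane := Or.inr him.ne'
  have hI' : -(Complex.I * s) ∈ Complex.slitPlane := Or.inr (by simpa using hs.ne')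
  have h1 : Tendsto (fun x : ℝ => Complex.log (((x⁻¹ : ℝ) : ℂ) + Complex.I * s)) atTop
      (𝓝 (Complex.log (Complex.I * s))) :=
    Tendsto.clog (by simpa using hinv.add_const (Complex.I * s)) hI
  have h2 : Tendsto (fun x : ℝ => Complex.log (((x⁻¹ : ℝ) : ℂ) + -(Complex.I * s))) atTop
      (𝓝 (Complex.log (-(Complex.I * s)))) :=
    Tendsto.clog (by simpa using hinv.add_const (-(Complex.I * s))) hI'
  have hlim : (Complex.log (Complex.I * s) - Complex.log (-(Complex.I * s))) / (2 * Complex.I)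
      = Real.pi / 2 := by
    rw [Complex.log, Complex.log, norm_neg, Complex.arg_neg_eq_arg_sub_pi_of_im_pos him]
    have := Complex.I_ne_zero
    push_cast
    field_simp
    ring
  rw [← hlim]
  refine ((h1.sub h2).div_const (2 * Complex.I)).congr' ?_
  filter_upwards [eventually_gt_atTop 0] with x hx
  have hx' : (x : ℂ) ≠ 0 := by exact_mod_cast hx.ne'
  have key : ∀ z : ℂ, 1 + z * x ∈ Complex.slitPlane →
      Complex.log (1 + z * x) = Real.log x + Complex.log (((x⁻¹ : ℝ) : ℂ) + z) := by
    intro z hz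
    have e : 1 + z * x = (x : ℂ) * (((x⁻¹ : ℝ) : ℂ) + z) := by
      push_cast
      field_simp
    rw [e]
    refine Complex.log_ofReal_mul hx fun h => Complex.slitPlane_ne_zero hz ?_
    rw [e, h, mul_zero]
  have e : Complex.I * s * ((-x : ℝ) : ℂ) = -(Complex.I * s) * x := by push_cast; ring
  have m1 := one_add_I_mul_mem_slitPlane hs x
  have m2 := one_add_I_mul_mem_slitPlane hs (-x)
  rw [e] at m2
  rw [arctanRay, e, key _ m1, key _ m2]
  ring

lemma hasDerivAt_ofReal_arctan (x : ℝ) :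
    HasDerivAt (fun y : ℝ => (Real.arctan y : ℂ)) (1 / (1 + (x : ℂ) ^ 2)) x := by
  simpa using (Real.hasDerivAt_arctan x).ofReal_comp

lemma tendsto_ofReal_arctan_atTop :
    Tendsto (fun x : ℝ => (Real.arctan x : ℂ)) atTop (𝓝 (Real.pi / 2)) := by
  simpa [Function.comp_def] using (Complex.continuous_ofReal.tendsto (Real.pi / 2)).comp
    (Real.tendsto_arctan_atTop.mono_right nhdsWithin_le_nhds)

lemma tendsto_div_one_add_sq_atTop :
    Tendsto (fun x : ℝ => (x : ℂ) / (1 + (x : ℂ) ^ 2)) atTop (𝓝 0) := by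
  have h : Tendsto (fun x : ℝ => x / (1 + x ^ 2)) atTop (𝓝 0) := by
    refine squeeze_zero' ?_ ?_ tendsto_inv_atTop_zero
    · filter_upwards [eventually_gt_atTop 0] with x hx
      positivity
    · filter_upwards [eventually_gt_atTop 0] with x hx
      rw [div_le_iff₀ (by positivity)]
      field_simp
      linarith
  simpa [Function.comp_def] using (Complex.continuous_ofReal.tendsto 0).comp h

lemma hasDerivAt_div_one_add_sq (x : ℝ) :
    HasDerivAt (fun y : ℝ => (y : ℂ) / (1 + (y : ℂ) ^ 2))
      ((1 - (x : ℂ) ^ 2) / (1 + (x : ℂ) ^ 2) ^ 2) x := by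
  have h := (hasDerivAt_id x).ofReal_comp
  refine (h.div ((h.pow 2).const_add 1) (one_add_ofReal_sq_ne_zero x)).congr_deriv ?_
  simp
  ring

/-- A primitive, vanishing at `0`, of `x² / ((1 + x²)² (1 + s² x²))`. -/
lemma exists_primitive {s : ℂ} (hs : 0 < s.re) :
    ∃ F : ℝ → ℂ, F 0 = 0 ∧ Tendsto F atTop (𝓝 (Real.pi / 4 * ((1 + s) ^ 2)⁻¹)) ∧
      ∀ x : ℝ, HasDerivAt F
        ((x : ℂ) ^ 2 / ((1 + (x : ℂ) ^ 2) ^ 2 * (1 + s ^ 2 * (x : ℂ) ^ 2))) x := by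
  have hs1 : 1 + s ≠ 0 := fun h => by
    have := congrArg Complex.re h
    simp at this
    linarith
  have hs0 : s ≠ 0 := fun h => by simp [h] at hs
  rcases eq_or_ne s 1 with rfl | hne
  · refine ⟨fun x => (1 / 8) * (Real.arctan x : ℂ) + (1 / 8) * ((x : ℂ) / (1 + (x : ℂ) ^ 2))
      * (1 - 2 * (1 + (x : ℂ) ^ 2)⁻¹), by simp, ?_, fun x => ?_⟩
    · have hinv : Tendsto (fun x : ℝ => (1 + (x : ℂ) ^ 2)⁻¹) atTop (𝓝 0) := by
        have h : Tendsto (fun x : ℝ => (1 + x ^ 2)⁻¹) atTop (𝓝 0) :=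
          tendsto_inv_atTop_zero.comp
            (tendsto_atTop_add_const_left _ 1 (tendsto_pow_atTop two_ne_zero))
        simpa [Function.comp_def] using (Complex.continuous_ofReal.tendsto 0).comp h
      convert (tendsto_ofReal_arctan_atTop.const_mul _).add
        ((tendsto_div_one_add_sq_atTop.const_mul _).mul ((hinv.const_mul 2).const_sub 1)) using 2
      norm_num
      ring
    · have n1 := one_add_ofReal_sq_ne_zero x
      have hinv := (((hasDerivAt_id x).ofReal_comp.pow 2).const_add 1).inv n1
      refine (((hasDerivAt_ofReal_arctan x).const_mul _).add
        (((hasDerivAt_div_one_add_sq x).const_mul _).mul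
          ((hinv.const_mul 2).const_sub 1))).congr_deriv ?_
      simp
      field_simp
      ring
  · have hs2 : s - 1 ≠ 0 := sub_ne_zero.mpr hne
    refine ⟨fun x => ((s - 1) ^ 2 * (1 + s) ^ 2)⁻¹ * (Real.arctan x : ℂ)
      + (2 * ((s - 1) * (1 + s)))⁻¹ * ((Real.arctan x : ℂ) + (x : ℂ) / (1 + (x : ℂ) ^ 2))
      - s / ((s - 1) ^ 2 * (1 + s) ^ 2) * arctanRay s x, by simp [arctanRay], ?_, fun x => ?_⟩
    · convert ((tendsto_ofReal_arctan_atTop.const_mul _).add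
        ((tendsto_ofReal_arctan_atTop.add tendsto_div_one_add_sq_atTop).const_mul _)).sub
        ((tendsto_arctanRay hs).const_mul _) using 2
      field_simp
      ring
    · refine ((((hasDerivAt_ofReal_arctan x).const_mul _).add
        (((hasDerivAt_ofReal_arctan x).add (hasDerivAt_div_one_add_sq x)).const_mul _)).sub
        ((hasDerivAt_arctanRay hs x).const_mul _)).congr_deriv ?_
      have n1 := one_add_ofReal_sq_ne_zero x
      have n2 := one_add_sq_mul_sq_ne_zero hs x
      field_simp
      ring

lemma integrableOn_sqrt_div {s : ℂ} (hs : 0 < s.re) :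
    IntegrableOn (fun τ : ℝ => (2 / Real.pi : ℂ) * (Real.sqrt τ : ℂ)
      / ((((1 + τ : ℝ)) : ℂ) ^ 2 * (1 + (τ : ℂ) * s ^ 2))) (Set.Ioi 0) := by
  have hdom : IntegrableOn (fun τ : ℝ => (2 / Real.pi * (‖s‖ ^ 2 / s.re ^ 2))
      * (τ + 1) ^ (-(3 / 2) : ℝ)) (Set.Ioi 0) :=
    (integrableOn_add_rpow_Ioi_of_lt (by norm_num) (by norm_num)).const_mul _
  refine hdom.mono' (Measurable.aestronglyMeasurable (by fun_prop)) ?_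
  filter_upwards [ae_restrict_mem measurableSet_Ioi] with τ (hτ : 0 < τ)
  have hb := sq_re_le_sq_norm_mul_norm_one_add hs (Real.sqrt τ)
  rw [← Complex.ofReal_pow, Real.sq_sqrt hτ.le, mul_comm (s ^ 2)] at hb
  have hn : 0 < ‖1 + (τ : ℂ) * s ^ 2‖ := by
    by_contra! h
    nlinarith [pow_pos hs 2, sq_nonneg ‖s‖]
  have hinv : ‖1 + (τ : ℂ) * s ^ 2‖⁻¹ ≤ ‖s‖ ^ 2 / s.re ^ 2 := by
    rw [inv_le_iff_one_le_mul₀ hn, div_mul_eq_mul_div, le_div_iff₀ (by positivity)]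
    linarith
  have hsqrt : Real.sqrt τ / (1 + τ) ^ 2 ≤ (τ + 1) ^ (-(3 / 2) : ℝ) := by
    rw [show (-(3 / 2) : ℝ) = 1 / 2 - (2 : ℕ) by norm_num, Real.rpow_sub (by positivity),
      ← Real.sqrt_eq_rpow, Real.rpow_natCast, add_comm τ 1]
    gcongr
    linarith
  calc _ = 2 / Real.pi * (Real.sqrt τ / (1 + τ) ^ 2 * ‖1 + (τ : ℂ) * s ^ 2‖⁻¹) := by
        rw [norm_div, norm_mul, norm_mul, norm_div, norm_pow, Complex.norm_of_nonneg
          (Real.sqrt_nonneg _), Complex.norm_of_nonneg Real.pi_pos.le, Complex.norm_of_nonneg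
          (by positivity), Complex.norm_two, div_eq_mul_inv _ (_ * _), mul_inv]
        ring
    _ ≤ 2 / Real.pi * ((τ + 1) ^ (-(3 / 2) : ℝ) * (‖s‖ ^ 2 / s.re ^ 2)) := by
        gcongr
    _ = _ := by ring

lemma integral_sqrt_div {s : ℂ} (hs : 0 < s.re) :
    ∫ τ in Set.Ioi (0 : ℝ), (2 / Real.pi : ℂ) * (Real.sqrt τ : ℂ)
      / ((((1 + τ : ℝ)) : ℂ) ^ 2 * (1 + (τ : ℂ) * s ^ 2)) = ((1 + s) ^ 2)⁻¹ := by
  obtain ⟨F, hF0, hFlim, hF⟩ := exists_primitive hs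
  have hpi : (Real.pi : ℂ) ≠ 0 := by exact_mod_cast Real.pi_ne_zero
  rw [integral_Ioi_of_hasDerivAt_of_tendsto (f := fun τ => (4 / Real.pi : ℂ) * F (Real.sqrt τ))
    (m := (4 / Real.pi : ℂ) * (Real.pi / 4 * ((1 + s) ^ 2)⁻¹)) ?_ ?_ (integrableOn_sqrt_div hs)
    ((hFlim.comp Real.tendsto_sqrt_atTop).const_mul _)]
  · rw [Real.sqrt_zero, hF0]
    field_simp
    simp
  · have hc : Continuous F := continuous_iff_continuousAt.mpr fun x => (hF x).continuousAt
    exact (continuous_const.mul (hc.comp Real.continuous_sqrt)).continuousWithinAt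
  · intro τ (hτ : 0 < τ)
    refine (((hF _).scomp τ (Real.hasDerivAt_sqrt hτ.ne')).const_mul _).congr_deriv ?_
    have hr : (Real.sqrt τ : ℂ) ≠ 0 := by exact_mod_cast (Real.sqrt_pos.mpr hτ).ne'
    have e : (τ : ℂ) = (Real.sqrt τ : ℂ) ^ 2 := by
      exact_mod_cast (Real.sq_sqrt hτ.le).symm
    have n1 := one_add_ofReal_sq_ne_zero (Real.sqrt τ)
    have n2 := one_add_sq_mul_sq_ne_zero hs (Real.sqrt τ)
    rw [Complex.real_smul]
    push_cast
    rw [e, mul_comm _ (s ^ 2)]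
    generalize (Real.sqrt τ : ℂ) = r at *
    field_simp
    ring

/-- ∫₀^∞ (2/π)√τ/((1+τ)²(1+τw)) dτ = 1/(1+√w)², for Re √w > 0 (principal branch). -/
theorem stmt8 (w : ℂ) (hw : 0 < (w ^ ((1 : ℂ) / 2)).re) :
    ∫ τ in Set.Ioi (0 : ℝ),
        (2 / Real.pi : ℂ) * (Real.sqrt τ : ℂ) / ((((1 + τ : ℝ)) : ℂ) ^ 2 * (1 + (τ : ℂ) * w))
      = ((1 + w ^ ((1 : ℂ) / 2)) ^ 2)⁻¹ := by
  have h := integral_sqrt_div hw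
  have hsq : (w ^ ((1 : ℂ) / 2)) ^ 2 = w := by
    rw [one_div]
    exact_mod_cast Complex.cpow_nat_inv_pow w two_ne_zero
  rwa [hsq] at h
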